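/- Let n ≥ 4 be an integer. Then for every integer j with 0 ≤ j ≤ n−1, one has min(j, n−j)·(1 − cos(2π/n)) ≤ 1 − cos(2πj/n). -/

import Mathlib

theorem wl_aux (n : ℕ) (hn : 4 ≤ n) (k : ℕ) (hk : 2 * k ≤ n) :
    (k : ℝ) * (1 - Real.cos (2 * Real.pi / n)) ≤ 1 - Real.cos (2 * Real.pi * k / n) := by
  have hn' : (4 : ℝ) ≤ n := by exact_mod_cast hn
  have hk' : 2 * (k : ℝ) ≤ n := by exact_mod_cast hk
  have hn0 : (0 : ℝ) < n := by linarith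
  have hpi := Real.pi_pos
  obtain rfl | rfl | rfl | h3 : k = 0 ∨ k = 1 ∨ k = 2 ∨ 3 ≤ k := by omega
  · simp
  · simp
  · have e : 2 * Real.pi * ((2 : ℕ) : ℝ) / n = 2 * (2 * Real.pi / n) := by push_cast; ring
    have hc : 0 ≤ Real.cos (2 * Real.pi / n) := by
      apply Real.cos_nonneg_of_neg_pi_div_two_le_of_le
      · have : 0 ≤ 2 * Real.pi / n := by positivity
        linarith
      · rw [div_le_iff₀ hn0]; nlinarith
    rw [e, Real.cos_two_mul]
    have := Real.cos_le_one (2 * Real.pi / n)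
    push_cast
    nlinarith
  · have h3' : (3 : ℝ) ≤ k := by exact_mod_cast h3
    have h1 := Real.one_sub_sq_div_two_le_cos (x := 2 * Real.pi / n)
    have h2 : Real.cos (2 * Real.pi * k / n) ≤ 1 - 2 / Real.pi ^ 2 * (2 * Real.pi * k / n) ^ 2 := by
      apply Real.cos_le_one_sub_mul_cos_sq
      rw [abs_of_nonneg (by positivity), div_le_iff₀ hn0]
      nlinarith
    have e2 : 2 / Real.pi ^ 2 * (2 * Real.pi * k / n) ^ 2 = 8 * (k : ℝ) ^ 2 / n ^ 2 := by
      field_simp; ring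
    have h4 : (k : ℝ) * (1 - Real.cos (2 * Real.pi / n)) ≤ k * ((2 * Real.pi / n) ^ 2 / 2) := by
      gcongr; linarith
    have e3 : (k : ℝ) * ((2 * Real.pi / n) ^ 2 / 2) = 2 * k * Real.pi ^ 2 / n ^ 2 := by
      ring
    have h5 : 2 * k * Real.pi ^ 2 / (n : ℝ) ^ 2 ≤ 8 * (k : ℝ) ^ 2 / n ^ 2 := by
      apply div_le_div_of_nonneg_right _ (by positivity)
      have : Real.pi ^ 2 ≤ 12 := by nlinarith [Real.pi_lt_d2]
      nlinarith
    linarith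

/-- For every integer `n ≥ 4` and `0 ≤ j ≤ n−1`,
`min(j, n−j)·(1 − cos(2π/n)) ≤ 1 − cos(2πj/n)`. -/
theorem wordLength_mul_one_sub_cos_le (n : ℕ) (hn : 4 ≤ n) (j : ℕ) (hj : j ≤ n - 1) :
    (min j (n - j) : ℕ) * (1 - Real.cos (2 * Real.pi / n))
      ≤ 1 - Real.cos (2 * Real.pi * j / n) := by
  rcases le_total j (n - j) with h | h
  · rw [min_eq_left h]
    exact wl_aux n hn j (by omega)
  · rw [min_eq_right h]
    have := wl_aux n hn (n - j) (by omega)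
    have hn0 : (n : ℝ) ≠ 0 := by
      have : n ≠ 0 := by omega
      exact_mod_cast this
    have e : 2 * Real.pi * ((n - j : ℕ) : ℝ) / n = 2 * Real.pi - 2 * Real.pi * j / n := by
      rw [Nat.cast_sub (by omega)]; field_simp
    rwa [e, Real.cos_two_pi_sub] at this
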